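/- Uniform concentration of a sub-Gaussian matrix against normalized low-rank differences (Lemma S.2). Let E ∈ ℝ^{n×n} be a symmetric random matrix with E₀(E) = 0 which is sub-Gaussian with variance proxy τ > 0, i.e., for every A ∈ ℝ^{n×n} with ‖A‖_F = 1 and every t > 0, P(|tr(AᵀE)| > t) ≤ 2e^{−τt²}. Fix X₀ ∈ ℝ^{n×d}. Then for every t > 0, P( sup_{X ∈ ℝ^{n×d}, XXᵀ ≠ X₀X₀ᵀ} | ⟨E, (XXᵀ − X₀X₀ᵀ)/‖XXᵀ − X₀X₀ᵀ‖_F⟩_F | > n t ) ≤ 6·exp( 3nd − τ n² t²/4 ). -/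

import Mathlib

open MeasureTheory Finset

/-- Frobenius squared norm of a rectangular array. -/
def frobSq {α β : Type*} [Fintype α] [Fintype β] (A : α → β → ℝ) : ℝ :=
  ∑ i, ∑ j, (A i j) ^ 2

/-- Frobenius inner product of two rectangular arrays. -/
def frobInner {α β : Type*} [Fintype α] [Fintype β] (A B : α → β → ℝ) : ℝ :=
  ∑ i, ∑ j, A i j * B i j

/-- Gram matrix `X Xᵀ` of an `n × d` array. -/
def gram {n d : ℕ} (X : Fin n → Fin d → ℝ) : Fin n → Fin n → ℝ :=
  fun i j => ∑ h, X i h * X j h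

open Metric Module in
/-- Volumetric bound for separated subsets of the unit ball of a normed space. -/
theorem card_le_of_separated_unit_ball {V : Type*} [NormedAddCommGroup V] [NormedSpace ℝ V]
    [FiniteDimensional ℝ V] {ε : ℝ} (hε : 0 < ε) (s : Finset V) (hs : ∀ c ∈ s, ‖c‖ ≤ 1)
    (h : ∀ c ∈ s, ∀ d ∈ s, c ≠ d → ε ≤ ‖c - d‖) :
    (s.card : ℝ) ≤ (1 + 2 / ε) ^ finrank ℝ V := by
  borelize V
  let μ : Measure V := Measure.addHaar
  have hδ : 0 < ε / 2 := by positivity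
  have hρ : 0 < 1 + ε / 2 := by positivity
  have hdisj : Set.Pairwise (s : Set V) (Function.onFun Disjoint fun c => ball (c : V) (ε / 2)) := by
    rintro c hc d hd hcd
    apply ball_disjoint_ball
    rw [dist_eq_norm, add_halves]
    exact h c hc d hd hcd
  have hsub : (⋃ c ∈ s, ball (c : V) (ε / 2)) ⊆ ball (0 : V) (1 + ε / 2) := by
    refine Set.iUnion₂_subset fun x hx => ball_subset_ball' ?_
    rw [dist_zero_right]
    linarith [hs x hx]
  have hvol : (s.card : ENNReal) * ENNReal.ofReal ((ε / 2) ^ finrank ℝ V) * μ (ball 0 1) ≤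
      ENNReal.ofReal ((1 + ε / 2) ^ finrank ℝ V) * μ (ball 0 1) :=
    calc
      _ = μ (⋃ c ∈ s, ball (c : V) (ε / 2)) := by
        rw [measure_biUnion_finset hdisj fun c _ => measurableSet_ball]
        simp only [μ.addHaar_ball_of_pos _ hδ, Finset.sum_const, nsmul_eq_mul, mul_assoc]
      _ ≤ μ (ball (0 : V) (1 + ε / 2)) := measure_mono hsub
      _ = _ := by simp only [μ.addHaar_ball_of_pos _ hρ]
  have hcard := ENNReal.toReal_le_of_le_ofReal (pow_nonneg hρ.le _)
    ((ENNReal.mul_le_mul_iff_left (measure_ball_pos _ _ zero_lt_one).ne'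
      measure_ball_lt_top.ne).1 hvol)
  rw [ENNReal.toReal_mul, ENNReal.toReal_ofReal (by positivity), ENNReal.toReal_natCast,
    ← le_div_iff₀ (by positivity), ← div_pow] at hcard
  have hratio : (1 + ε / 2) / (ε / 2) = 1 + 2 / ε := by
    field_simp
    ring
  rwa [hratio] at hcard

open Module in
/-- The unit ball of a normed space admits a finite `ε`-net of volumetric size. -/
theorem exists_net_unit_ball (V : Type*) [NormedAddCommGroup V] [NormedSpace ℝ V]
    [FiniteDimensional ℝ V] {ε : ℝ} (hε : 0 < ε) :
    ∃ N : Finset V, (∀ c ∈ N, ‖c‖ ≤ 1) ∧ (∀ x : V, ‖x‖ ≤ 1 → ∃ c ∈ N, ‖x - c‖ ≤ ε) ∧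
      (N.card : ℝ) ≤ (1 + 2 / ε) ^ finrank ℝ V := by
  classical
  let S : Set ℕ := {k | ∃ N : Finset V, (∀ c ∈ N, ‖c‖ ≤ 1) ∧
    (∀ c ∈ N, ∀ d ∈ N, c ≠ d → ε ≤ ‖c - d‖) ∧ N.card = k}
  have hne : S.Nonempty := ⟨0, ∅, by simp⟩
  have hbdd : BddAbove S := by
    refine ⟨⌊(1 + 2 / ε) ^ finrank ℝ V⌋₊, ?_⟩
    rintro _ ⟨N, h1, h2, rfl⟩
    exact Nat.le_floor (card_le_of_separated_unit_ball hε N h1 h2)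
  obtain ⟨N, hN, hsep, hcard⟩ := Nat.sSup_mem hne hbdd
  refine ⟨N, hN, fun x hx => ?_, card_le_of_separated_unit_ball hε N hN hsep⟩
  by_contra! hfar
  have hxN : x ∉ N := fun hmem => by
    have := hfar x hmem
    simp only [sub_self, norm_zero] at this
    linarith
  have hmem : N.card + 1 ∈ S := by
    refine ⟨insert x N, ?_, ?_, Finset.card_insert_of_notMem hxN⟩
    · intro c hc
      rcases Finset.mem_insert.1 hc with rfl | hc
      exacts [hx, hN c hc]
    · intro c hc d hd hcd
      rcases Finset.mem_insert.1 hc with hcx | hcN <;> rcases Finset.mem_insert.1 hd with hdx | hdN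
      · exact absurd (hcx.trans hdx.symm) hcd
      · exact hcx ▸ (hfar d hdN).le
      · rw [norm_sub_rev]
        exact hdx ▸ (hfar c hcN).le
      · exact hsep c hcN d hdN hcd
  have := le_csSup hbdd hmem
  omega

/-- A bounded function on the unit ball whose oscillation at scale `ε` is at most a fifth of any
uniform bound is controlled on the ball by its values on an `ε`-net. -/
theorem abs_le_of_abs_le_on_net {V : Type*} [NormedAddCommGroup V] {ε v B : ℝ} {F : V → ℝ}
    {N : Finset V} (hN : ∀ c ∈ N, ‖c‖ ≤ 1) (hcover : ∀ x : V, ‖x‖ ≤ 1 → ∃ c ∈ N, ‖x - c‖ ≤ ε)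
    (hB : ∀ x, ‖x‖ ≤ 1 → |F x| ≤ B)
    (hosc : ∀ s, (∀ x, ‖x‖ ≤ 1 → |F x| ≤ s) →
      ∀ x y, ‖x‖ ≤ 1 → ‖y‖ ≤ 1 → ‖x - y‖ ≤ ε → |F x - F y| ≤ s / 5)
    (hv : ∀ c ∈ N, |F c| ≤ 4 / 5 * v) {x : V} (hx : ‖x‖ ≤ 1) : |F x| ≤ v := by
  let T : Set ℝ := (fun x => |F x|) '' {x | ‖x‖ ≤ 1}
  have hbdd : BddAbove T := ⟨B, by rintro _ ⟨y, hy, rfl⟩; exact hB y hy⟩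
  have hsup : ∀ y, ‖y‖ ≤ 1 → |F y| ≤ sSup T := fun y hy => le_csSup hbdd ⟨y, hy, rfl⟩
  have hT : sSup T ≤ 4 / 5 * v + sSup T / 5 := by
    refine csSup_le ⟨_, x, hx, rfl⟩ ?_
    rintro _ ⟨y, hy, rfl⟩
    obtain ⟨c, hc, hyc⟩ := hcover y hy
    have h1 := hosc _ hsup y c hy (hN c hc) hyc
    have h2 := abs_sub_abs_le_abs_sub (F y) (F c)
    have h3 := hv c hc
    dsimp only
    linarith
  linarith [hsup x hx]

/-- The sub-Gaussian tail in direction `a` persists for all `a` in the unit ball. -/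
theorem subGaussian_tail_of_norm_le_one {Ω H : Type*} [MeasurableSpace Ω] [NormedAddCommGroup H]
    [InnerProductSpace ℝ H] {P : Measure Ω} {e : Ω → H} {τ : ℝ}
    (he : ∀ a : H, ‖a‖ = 1 → ∀ s : ℝ, 0 < s →
      P {ω | s < |inner ℝ (e ω) a|} ≤ ENNReal.ofReal (2 * Real.exp (-(τ * s ^ 2))))
    {a : H} (ha : ‖a‖ ≤ 1) {s : ℝ} (hs : 0 < s) :
    P {ω | s < |inner ℝ (e ω) a|} ≤ ENNReal.ofReal (2 * Real.exp (-(τ * s ^ 2))) := by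
  rcases eq_or_ne a 0 with rfl | ha0
  · simp [hs.le.not_gt]
  have hpos : 0 < ‖a‖ := norm_pos_iff.2 ha0
  refine (measure_mono fun ω hω => ?_).trans
    (he (‖a‖⁻¹ • a) (by rw [norm_smul, norm_inv, norm_norm, inv_mul_cancel₀ hpos.ne']) s hs)
  simp only [Set.mem_ofPred_eq, inner_smul_right, abs_mul, abs_inv, abs_norm] at hω ⊢
  exact hω.trans_le (le_mul_of_one_le_left (abs_nonneg _) ((one_le_inv₀ hpos).2 ha))

open Module in
/-- Union bound over a net of the unit ball of the parameter space `V`. -/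
theorem subGaussian_tail_over_unit_ball {Ω H V : Type*} [MeasurableSpace Ω]
    [NormedAddCommGroup H] [InnerProductSpace ℝ H] [NormedAddCommGroup V] [NormedSpace ℝ V]
    [FiniteDimensional ℝ V] {P : Measure Ω} {e : Ω → H} {τ : ℝ}
    (he : ∀ a : H, ‖a‖ = 1 → ∀ s : ℝ, 0 < s →
      P {ω | s < |inner ℝ (e ω) a|} ≤ ENNReal.ofReal (2 * Real.exp (-(τ * s ^ 2))))
    (Φ : V → H) (hΦ : ∀ x, ‖x‖ ≤ 1 → ‖Φ x‖ ≤ 1)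
    (hosc : ∀ ω s, (∀ x, ‖x‖ ≤ 1 → |inner ℝ (e ω) (Φ x)| ≤ s) →
      ∀ x y, ‖x‖ ≤ 1 → ‖y‖ ≤ 1 → ‖x - y‖ ≤ 1 / 20 →
        |inner ℝ (e ω) (Φ x) - inner ℝ (e ω) (Φ y)| ≤ s / 5)
    {v : ℝ} (hv : 0 < v) :
    P {ω | ∃ x, ‖x‖ ≤ 1 ∧ v < |inner ℝ (e ω) (Φ x)|} ≤
      ENNReal.ofReal (41 ^ finrank ℝ V * (2 * Real.exp (-(τ * (4 / 5 * v) ^ 2)))) := by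
  obtain ⟨N, hN, hcover, hcard⟩ := exists_net_unit_ball V (ε := 1 / 20) (by norm_num)
  have hsub : {ω | ∃ x, ‖x‖ ≤ 1 ∧ v < |inner ℝ (e ω) (Φ x)|} ⊆
      ⋃ c ∈ N, {ω | 4 / 5 * v < |inner ℝ (e ω) (Φ c)|} := by
    rintro ω ⟨x, hx, hlt⟩
    by_contra hω
    simp only [Set.mem_iUnion, Set.mem_ofPred_eq, not_exists, not_lt] at hω
    refine hlt.not_ge (abs_le_of_abs_le_on_net (F := fun x => inner ℝ (e ω) (Φ x)) (B := ‖e ω‖)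
      hN hcover (fun y hy => ?_) (hosc ω) hω hx)
    exact (abs_real_inner_le_norm _ _).trans (mul_le_of_le_one_right (norm_nonneg _) (hΦ y hy))
  calc
    _ ≤ ∑ c ∈ N, P {ω | 4 / 5 * v < |inner ℝ (e ω) (Φ c)|} :=
      (measure_mono hsub).trans (measure_biUnion_finset_le _ _)
    _ ≤ ∑ _c ∈ N, ENNReal.ofReal (2 * Real.exp (-(τ * (4 / 5 * v) ^ 2))) :=
      Finset.sum_le_sum fun c hc =>
        subGaussian_tail_of_norm_le_one he (hΦ c (hN c hc)) (by positivity)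
    _ ≤ _ := by
      rw [Finset.sum_const, nsmul_eq_mul, ← ENNReal.ofReal_natCast,
        ← ENNReal.ofReal_mul (Nat.cast_nonneg _)]
      refine ENNReal.ofReal_le_ofReal (mul_le_mul_of_nonneg_right (hcard.trans_eq ?_) (by positivity))
      norm_num

/-- The bilinear map `(Y, Z) ↦ Y Zᵀ`, valued in the Frobenius inner product space. -/
noncomputable def outerProd (n d : ℕ) : (Fin n → Fin d → ℝ) →ₗ[ℝ] (Fin n → Fin d → ℝ) →ₗ[ℝ]
    EuclideanSpace ℝ (Fin n × Fin n) :=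
  LinearMap.mk₂ ℝ (fun Y Z => WithLp.toLp 2 fun p => ∑ h, Y p.1 h * Z p.2 h)
    (fun Y Y' Z => by ext p; simp [add_mul, Finset.sum_add_distrib])
    (fun c Y Z => by ext p; simp [mul_assoc, Finset.mul_sum])
    (fun Y Z Z' => by ext p; simp [mul_add, Finset.sum_add_distrib])
    (fun c Y Z => by ext p; simp [mul_left_comm, Finset.mul_sum])

@[simp]
theorem outerProd_apply {n d : ℕ} (Y Z : Fin n → Fin d → ℝ) (p : Fin n × Fin n) :
    outerProd n d Y Z p = ∑ h, Y p.1 h * Z p.2 h := rfl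

/-- The matrix `Yᵀ Z`, valued in the Frobenius inner product space. -/
noncomputable def crossProd {n d : ℕ} (Y Z : Fin n → Fin d → ℝ) :
    EuclideanSpace ℝ (Fin d × Fin d) :=
  WithLp.toLp 2 fun p => ∑ i, Y i p.1 * Z i p.2

theorem inner_outerProd_outerProd {n d : ℕ} (A B C D : Fin n → Fin d → ℝ) :
    inner ℝ (outerProd n d A B) (outerProd n d C D) =
      inner ℝ (crossProd A C) (crossProd B D) := by
  simp only [PiLp.inner_apply, outerProd_apply, crossProd, RCLike.inner_apply, conj_trivial,
    Fintype.sum_prod_type, Finset.sum_mul_sum]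
  calc
    _ = ∑ i, ∑ h, ∑ j, ∑ k, C i h * D j h * (A i k * B j k) :=
      Finset.sum_congr rfl fun i _ => Finset.sum_comm
    _ = ∑ h, ∑ i, ∑ k, ∑ j, C i h * D j h * (A i k * B j k) := by
      rw [Finset.sum_comm]
      exact Finset.sum_congr rfl fun h _ => Finset.sum_congr rfl fun i _ => Finset.sum_comm
    _ = ∑ h, ∑ k, ∑ i, ∑ j, C i h * D j h * (A i k * B j k) :=
      Finset.sum_congr rfl fun h _ => Finset.sum_comm
    _ = _ := by
      rw [Finset.sum_comm]
      refine Finset.sum_congr rfl fun k _ => Finset.sum_congr rfl fun h _ => ?_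
      rw [Finset.sum_comm]
      refine Finset.sum_congr rfl fun i _ => Finset.sum_congr rfl fun j _ => ?_
      ring

theorem inner_outerProd_comm {n d : ℕ} {a : EuclideanSpace ℝ (Fin n × Fin n)}
    (ha : ∀ i j, a (i, j) = a (j, i)) (Y Z : Fin n → Fin d → ℝ) :
    inner ℝ a (outerProd n d Y Z) = inner ℝ a (outerProd n d Z Y) := by
  simp only [PiLp.inner_apply, outerProd_apply, RCLike.inner_apply, conj_trivial,
    Fintype.sum_prod_type]
  rw [Finset.sum_comm]
  refine Finset.sum_congr rfl fun i _ => Finset.sum_congr rfl fun j _ => ?_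
  rw [ha]
  simp only [mul_comm]

theorem norm_outerProd_self {n d : ℕ} (Y : Fin n → Fin d → ℝ) :
    ‖outerProd n d Y Y‖ = ‖crossProd Y Y‖ := by
  rw [@norm_eq_sqrt_real_inner _ _ _ (outerProd n d Y Y), inner_outerProd_outerProd,
    ← norm_eq_sqrt_real_inner]

/-- `‖Y Zᵀ‖² ≤ ‖Y Yᵀ‖ ‖Z Zᵀ‖` in Frobenius norm. -/
theorem norm_outerProd_sq_le {n d : ℕ} (Y Z : Fin n → Fin d → ℝ) :
    ‖outerProd n d Y Z‖ ^ 2 ≤ ‖outerProd n d Y Y‖ * ‖outerProd n d Z Z‖ := by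
  rw [← real_inner_self_eq_norm_sq, inner_outerProd_outerProd, norm_outerProd_self,
    norm_outerProd_self]
  exact real_inner_le_norm _ _

/-- Arrays with the Schatten-4 norm `Y ↦ ‖Y Yᵀ‖_F ^ (1/2)`. -/
def SchattenFour (n d : ℕ) : Type := Fin n → Fin d → ℝ

namespace SchattenFour

variable {n d : ℕ}

instance : AddCommGroup (SchattenFour n d) :=
  inferInstanceAs (AddCommGroup (Fin n → Fin d → ℝ))

instance : Module ℝ (SchattenFour n d) :=
  inferInstanceAs (Module ℝ (Fin n → Fin d → ℝ))

instance : FiniteDimensional ℝ (SchattenFour n d) :=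
  inferInstanceAs (FiniteDimensional ℝ (Fin n → Fin d → ℝ))

/-- `outerProd` with both arguments in `SchattenFour n d`. -/
noncomputable def outer : SchattenFour n d →ₗ[ℝ] SchattenFour n d →ₗ[ℝ]
    EuclideanSpace ℝ (Fin n × Fin n) :=
  outerProd n d

noncomputable instance : Norm (SchattenFour n d) := ⟨fun Y => Real.sqrt ‖outer Y Y‖⟩

theorem norm_sq (Y : SchattenFour n d) : ‖Y‖ ^ 2 = ‖outer Y Y‖ :=
  Real.sq_sqrt (norm_nonneg _)

theorem norm_nonneg_aux (Y : SchattenFour n d) : 0 ≤ ‖Y‖ := Real.sqrt_nonneg _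

theorem norm_outer_le (Y Z : SchattenFour n d) : ‖outer Y Z‖ ≤ ‖Y‖ * ‖Z‖ := by
  refine le_of_sq_le_sq ?_ (mul_nonneg (norm_nonneg_aux Y) (norm_nonneg_aux Z))
  rw [mul_pow, norm_sq, norm_sq]
  exact norm_outerProd_sq_le Y Z

theorem eq_zero_of_outer_self {Y : SchattenFour n d} (h : outer Y Y = 0) : Y = 0 := by
  funext i k
  have hi : ∑ h, Y i h * Y i h = 0 := congrArg (fun a => a.ofLp (i, i)) h
  exact mul_self_eq_zero.1
    ((Finset.sum_eq_zero_iff_of_nonneg fun h _ => mul_self_nonneg (Y i h)).1 hi k (Finset.mem_univ k))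

theorem core : NormedSpace.Core ℝ (SchattenFour n d) where
  norm_nonneg := norm_nonneg_aux
  norm_smul c Y := by
    refine (pow_left_inj₀ (norm_nonneg_aux _)
      (mul_nonneg (norm_nonneg c) (norm_nonneg_aux Y)) two_ne_zero).1 ?_
    rw [mul_pow, norm_sq, norm_sq, map_smul, map_smul, LinearMap.smul_apply, norm_smul, norm_smul]
    ring
  norm_triangle Y Z := by
    refine le_of_sq_le_sq ?_ (add_nonneg (norm_nonneg_aux Y) (norm_nonneg_aux Z))
    rw [norm_sq, LinearMap.map_add₂, map_add, map_add]
    refine (norm_add_le_of_le (norm_add_le_of_le (norm_outer_le Y Y) (norm_outer_le Y Z))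
      (norm_add_le_of_le (norm_outer_le Z Y) (norm_outer_le Z Z))).trans_eq ?_
    ring
  norm_eq_zero_iff Y := by
    rw [← pow_eq_zero_iff two_ne_zero, norm_sq, norm_eq_zero]
    exact ⟨eq_zero_of_outer_self, fun h => by simp [h]⟩

noncomputable instance : NormedAddCommGroup (SchattenFour n d) := .ofCore core

noncomputable instance : NormedSpace ℝ (SchattenFour n d) := .ofCore core

theorem finrank_eq : Module.finrank ℝ (SchattenFour n d) = n * d := by
  change Module.finrank ℝ (Fin n → Fin d → ℝ) = n * d
  simp [Module.finrank_pi_fintype]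

end SchattenFour

/-- A symmetric bilinear form bounded by `s` on the diagonal of the unit ball oscillates, along
the diagonal, by at most `s / 5` at scale `1 / 20`. -/
theorem abs_diag_sub_diag_le {V : Type*} [NormedAddCommGroup V] [NormedSpace ℝ V]
    (b : V →ₗ[ℝ] V →ₗ[ℝ] ℝ) (hb : ∀ x y, b x y = b y x) {s : ℝ}
    (hs : ∀ x, ‖x‖ ≤ 1 → |b x x| ≤ s) {x y : V} (hx : ‖x‖ ≤ 1) (hy : ‖y‖ ≤ 1)
    (hxy : ‖x - y‖ ≤ 1 / 20) : |b x x - b y y| ≤ s / 5 := by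
  let D : V := (10 : ℝ) • (x - y)
  let S : V := (1 / 4 : ℝ) • (x + y)
  have hD : ‖D‖ ≤ 1 / 2 := by
    rw [norm_smul]
    norm_num
    linarith
  have hS : ‖S‖ ≤ 1 / 2 := by
    rw [norm_smul]
    norm_num
    linarith [norm_add_le x y]
  have h1 := hs (D + S) ((norm_add_le D S).trans (by linarith))
  have h2 := hs (D - S) ((norm_sub_le D S).trans (by linarith))
  have hid : b x x - b y y = (b (D + S) (D + S) - b (D - S) (D - S)) / 10 := by
    simp only [D, S, map_add, map_sub, map_smul, LinearMap.add_apply, LinearMap.sub_apply,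
      LinearMap.smul_apply, smul_eq_mul, hb y x]
    ring
  rw [hid, abs_le]
  rw [abs_le] at h1 h2
  constructor <;> linarith

/-- Decomposition of `X Xᵀ - X₀ X₀ᵀ` into an element of the linear space `{X₀ Zᵀ + Z X₀ᵀ}` and an
orthogonal positive semidefinite part `Y Yᵀ`. -/
theorem exists_orthogonal_decomposition {n d : ℕ} (X₀ X : Fin n → Fin d → ℝ) :
    ∃ Y Z : Fin n → Fin d → ℝ,
      outerProd n d X X - outerProd n d X₀ X₀ =
        (outerProd n d X₀ Z + outerProd n d Z X₀) + outerProd n d Y Y ∧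
      inner ℝ (outerProd n d X₀ Z + outerProd n d Z X₀) (outerProd n d Y Y) = 0 := by
  let x₀ : Fin d → EuclideanSpace ℝ (Fin n) := fun k => WithLp.toLp 2 fun i => X₀ i k
  let K : Submodule ℝ (EuclideanSpace ℝ (Fin n)) := Submodule.span ℝ (Set.range x₀)
  have hproj : ∀ h, ∃ c : Fin d → ℝ, ∃ y ∈ Kᗮ,
      WithLp.toLp 2 (fun i => X i h) = ∑ k, c k • x₀ k + y := by
    intro h
    obtain ⟨p, hp, y, hy, hxy⟩ := K.exists_add_mem_mem_orthogonal (WithLp.toLp 2 fun i => X i h)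
    obtain ⟨c, rfl⟩ := (Submodule.mem_span_range_iff_exists_fun ℝ).1 hp
    exact ⟨c, y, hy, hxy⟩
  choose C y hy hX using hproj
  let Y : Fin n → Fin d → ℝ := fun i h => y h i
  let W : Fin n → Fin d → ℝ := fun i h => ∑ k, C h k * X₀ i k
  let R : (Fin n → Fin d → ℝ) → Fin n → Fin d → ℝ := fun U i k => ∑ h, U i h * C h k
  have hXWY : X = W + Y := by
    funext i h
    simpa [W, Y, x₀] using congrArg (fun a => a.ofLp i) (hX h)
  have hleft : ∀ U, outerProd n d X₀ (R U) = outerProd n d W U := by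
    intro U
    ext p
    simp only [outerProd_apply, R, W, Finset.mul_sum, Finset.sum_mul]
    rw [Finset.sum_comm]
    exact Finset.sum_congr rfl fun h _ => Finset.sum_congr rfl fun k _ => by ring
  have hright : ∀ U, outerProd n d (R U) X₀ = outerProd n d U W := by
    intro U
    ext p
    simp only [outerProd_apply, R, W, Finset.mul_sum, Finset.sum_mul]
    rw [Finset.sum_comm]
    exact Finset.sum_congr rfl fun h _ => Finset.sum_congr rfl fun k _ => by ring
  have hcross : crossProd X₀ Y = 0 := by
    ext p
    have := (Submodule.mem_orthogonal K (y p.2)).1 (hy p.2) (x₀ p.1)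
      (Submodule.subset_span ⟨p.1, rfl⟩)
    simpa [crossProd, Y, x₀, PiLp.inner_apply, mul_comm] using this
  refine ⟨Y, (1 / 2 : ℝ) • (R W - X₀) + R Y, ?_, ?_⟩
  · rw [hXWY]
    simp only [map_add, map_sub, map_smul, LinearMap.add_apply, LinearMap.sub_apply,
      LinearMap.smul_apply, hleft, hright]
    module
  · rw [inner_add_left, inner_outerProd_outerProd, inner_outerProd_outerProd, hcross,
      inner_zero_left, inner_zero_right, add_zero]

/-- The linear map `Z ↦ X₀ Zᵀ + Z X₀ᵀ`. -/
noncomputable def symOuter {n d : ℕ} (X₀ : Fin n → Fin d → ℝ) :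
    (Fin n → Fin d → ℝ) →ₗ[ℝ] EuclideanSpace ℝ (Fin n × Fin n) :=
  outerProd n d X₀ + (outerProd n d).flip X₀

theorem finrank_range_symOuter_le {n d : ℕ} (X₀ : Fin n → Fin d → ℝ) :
    Module.finrank ℝ (LinearMap.range (symOuter X₀)) ≤ n * d :=
  (LinearMap.finrank_range_le (symOuter X₀)).trans_eq SchattenFour.finrank_eq

/-- Tail bound over the unit ball of a linear subspace. -/
theorem subGaussian_tail_over_submodule {Ω H : Type*} [MeasurableSpace Ω]
    [NormedAddCommGroup H] [InnerProductSpace ℝ H] {P : Measure Ω} {e : Ω → H} {τ : ℝ}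
    (he : ∀ a : H, ‖a‖ = 1 → ∀ s : ℝ, 0 < s →
      P {ω | s < |inner ℝ (e ω) a|} ≤ ENNReal.ofReal (2 * Real.exp (-(τ * s ^ 2))))
    (L : Submodule ℝ H) [FiniteDimensional ℝ L] {v : ℝ} (hv : 0 < v) :
    P {ω | ∃ a ∈ L, v * ‖a‖ < |inner ℝ (e ω) a|} ≤
      ENNReal.ofReal (41 ^ Module.finrank ℝ L * (2 * Real.exp (-(τ * (4 / 5 * v) ^ 2)))) := by
  refine (measure_mono ?_).trans (subGaussian_tail_over_unit_ball he (fun x : L => (x : H))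
    (fun x hx => hx) (fun ω s hs x y hx hy hxy => ?_) hv)
  · rintro ω ⟨a, haL, ha⟩
    have hpos : 0 < ‖a‖ := norm_pos_iff.2 (by rintro rfl; simp at ha)
    refine ⟨‖a‖⁻¹ • ⟨a, haL⟩, ?_, ?_⟩
    · rw [norm_smul, norm_inv, norm_norm, Submodule.coe_norm, inv_mul_cancel₀ hpos.ne']
    · rw [Submodule.coe_smul, inner_smul_right, abs_mul, abs_inv, abs_norm]
      rwa [inv_mul_eq_div, lt_div_iff₀ hpos]
  · have hz := hs ((20 : ℝ) • (x - y)) (by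
      rw [norm_smul, Real.norm_of_nonneg (by norm_num)]
      linarith)
    rw [Submodule.coe_smul, Submodule.coe_sub, inner_smul_right, inner_sub_right, abs_mul] at hz
    norm_num at hz
    have := abs_nonneg (inner ℝ (e ω) (x : H) - inner ℝ (e ω) (y : H))
    linarith

/-- Tail bound over the positive semidefinite matrices `Y Yᵀ`. -/
theorem subGaussian_tail_over_outerProd_self {Ω : Type*} [MeasurableSpace Ω] {n d : ℕ}
    {P : Measure Ω} {e : Ω → EuclideanSpace ℝ (Fin n × Fin n)} {τ : ℝ}
    (he : ∀ a : EuclideanSpace ℝ (Fin n × Fin n), ‖a‖ = 1 → ∀ s : ℝ, 0 < s →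
      P {ω | s < |inner ℝ (e ω) a|} ≤ ENNReal.ofReal (2 * Real.exp (-(τ * s ^ 2))))
    (hsymm : ∀ ω i j, e ω (i, j) = e ω (j, i)) {v : ℝ} (hv : 0 < v) :
    P {ω | ∃ Y, v * ‖outerProd n d Y Y‖ < |inner ℝ (e ω) (outerProd n d Y Y)|} ≤
      ENNReal.ofReal (41 ^ (n * d) * (2 * Real.exp (-(τ * (4 / 5 * v) ^ 2)))) := by
  rw [← SchattenFour.finrank_eq (n := n) (d := d)]
  refine (measure_mono ?_).trans (subGaussian_tail_over_unit_ball he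
    (fun Y : SchattenFour n d => SchattenFour.outer Y Y)
    (fun Y hY => ?_) (fun ω s hs x y hx hy hxy => ?_) hv)
  · rintro ω ⟨Y, hlt⟩
    change SchattenFour n d at Y
    change v * ‖SchattenFour.outer Y Y‖ < |inner ℝ (e ω) (SchattenFour.outer Y Y)| at hlt
    have hpos : 0 < ‖Y‖ := norm_pos_iff.2 (by rintro rfl; simp at hlt)
    refine ⟨‖Y‖⁻¹ • Y, ?_, ?_⟩
    · rw [norm_smul, norm_inv, norm_norm, inv_mul_cancel₀ hpos.ne']
    · rw [map_smul, map_smul, LinearMap.smul_apply, smul_smul, inner_smul_right, abs_mul,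
        abs_mul, abs_inv, abs_norm, ← mul_inv, ← sq, inv_mul_eq_div, lt_div_iff₀ (by positivity),
        SchattenFour.norm_sq]
      exact hlt
  · exact (SchattenFour.norm_outer_le Y Y).trans (mul_le_one₀ hY (norm_nonneg _) hY)
  · refine abs_diag_sub_diag_le
      (SchattenFour.outer.compr₂ (innerₛₗ ℝ (e ω))) (fun Y Z => ?_) hs hx hy hxy
    exact inner_outerProd_comm (hsymm ω) Y Z

/-- If `a ⟂ b` and `|⟨e, a + b⟩| > u ‖a + b‖`, then one of the two parts has a large normalized
inner product with `e`. -/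
theorem lt_abs_inner_or_of_orthogonal {H : Type*} [NormedAddCommGroup H] [InnerProductSpace ℝ H]
    {e a b : H} {u : ℝ} (hu : 0 ≤ u) (hab : inner ℝ a b = 0)
    (h : u * ‖a + b‖ < |inner ℝ e (a + b)|) :
    u / √2 * ‖a‖ < |inner ℝ e a| ∨ u / √2 * ‖b‖ < |inner ℝ e b| := by
  by_contra! hle
  have hpyth := norm_add_sq_eq_norm_sq_add_norm_sq_of_inner_eq_zero a b hab
  have hsum : ‖a‖ + ‖b‖ ≤ √2 * ‖a + b‖ := by
    refine le_of_sq_le_sq ?_ (by positivity)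
    rw [mul_pow, Real.sq_sqrt zero_le_two]
    nlinarith [sq_nonneg (‖a‖ - ‖b‖)]
  have hkey : u / √2 * (‖a‖ + ‖b‖) ≤ u * ‖a + b‖ := by
    refine (mul_le_mul_of_nonneg_left hsum (by positivity)).trans_eq ?_
    field_simp
  rw [inner_add_right] at h
  linarith [abs_add_le (inner ℝ e a) (inner ℝ e b), hle.1, hle.2]

/-- Comparison of the net bound with the target, unless the target is trivial. -/
theorem net_bound_le_or_one_le (D : ℕ) (q : ℝ) :
    1 ≤ 6 * Real.exp (3 * D - q / 4) ∨
      41 ^ D * (2 * Real.exp (-(8 / 25 * q))) ≤ 3 * Real.exp (3 * D - q / 4) := by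
  rcases le_or_gt q (12 * D) with hq | hq
  · left
    have := Real.one_le_exp (x := 3 * D - q / 4) (by linarith)
    linarith
  · right
    have h41 : (41 : ℝ) ≤ Real.exp (15 / 4) := by
      refine le_of_pow_le_pow_left₀ four_ne_zero (Real.exp_pos _).le ?_
      rw [← Real.exp_nat_mul]
      calc (41 : ℝ) ^ 4 ≤ 2.7 ^ 15 := by norm_num
        _ ≤ Real.exp 1 ^ 15 := by
          gcongr
          linarith [Real.exp_one_gt_d9]
        _ = _ := by
          rw [← Real.exp_nat_mul]
          norm_num
    calc 41 ^ D * (2 * Real.exp (-(8 / 25 * q)))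
        ≤ Real.exp (15 / 4) ^ D * (2 * Real.exp (-(8 / 25 * q))) := by gcongr
      _ = 2 * Real.exp (15 / 4 * D - 8 / 25 * q) := by
        rw [← Real.exp_nat_mul, mul_left_comm, ← Real.exp_add]
        ring_nf
      _ ≤ 3 * Real.exp (3 * D - q / 4) := by
        have : (0 : ℝ) ≤ D := Nat.cast_nonneg D
        refine mul_le_mul (by norm_num) (Real.exp_le_exp.2 ?_) (Real.exp_pos _).le (by norm_num)
        linarith

theorem inner_toLp_eq_frobInner {n : ℕ} (A B : Fin n → Fin n → ℝ) :
    inner ℝ (WithLp.toLp 2 fun p : Fin n × Fin n => A p.1 p.2 : EuclideanSpace ℝ (Fin n × Fin n))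
      (WithLp.toLp 2 fun p => B p.1 p.2) = frobInner A B := by
  simp [PiLp.inner_apply, frobInner, Fintype.sum_prod_type, mul_comm]

theorem norm_toLp_eq_sqrt_frobSq {n : ℕ} (A : Fin n → Fin n → ℝ) :
    ‖(WithLp.toLp 2 fun p => A p.1 p.2 : EuclideanSpace ℝ (Fin n × Fin n))‖ =
      √(frobSq A) := by
  simp [EuclideanSpace.norm_eq, frobSq, Fintype.sum_prod_type]

/-- Uniform concentration of a sub-Gaussian matrix against normalized
low-rank differences (Lemma S.2). If `E` is a symmetric mean-zero random matrix that is
sub-Gaussian with variance proxy `τ`, then for every `t > 0`,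
`P(sup_X |⟨E, (XXᵀ − X₀X₀ᵀ)/‖XXᵀ − X₀X₀ᵀ‖_F⟩| > n t) ≤ 6 exp(3nd − τ n² t²/4)`,
where the supremum exceeding `n t` is expressed as the existence of some `X` with
`XXᵀ ≠ X₀X₀ᵀ` whose normalized inner product exceeds `n t`. -/
theorem subGaussian_uniform_concentration {n d : ℕ}
    {Ω : Type*} [MeasurableSpace Ω] (P : Measure Ω) [IsProbabilityMeasure P]
    (E : Ω → Fin n → Fin n → ℝ)
    (hmeas : ∀ i j, Measurable fun ω => E ω i j)
    (hsymm : ∀ ω i j, E ω i j = E ω j i)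
    (hmean : ∀ i j, ∫ ω, E ω i j ∂P = 0)
    (τ : ℝ) (hτ : 0 < τ)
    (hsubG : ∀ A : Fin n → Fin n → ℝ, frobSq A = 1 → ∀ s : ℝ, 0 < s →
      P {ω | s < |frobInner A (E ω)|} ≤ ENNReal.ofReal (2 * Real.exp (-(τ * s ^ 2))))
    (X₀ : Fin n → Fin d → ℝ) (t : ℝ) (ht : 0 < t) :
    P {ω | ∃ X : Fin n → Fin d → ℝ, gram X ≠ gram X₀ ∧
          (n : ℝ) * t <
            |frobInner (E ω)
              (fun i j => (gram X i j - gram X₀ i j)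
                / Real.sqrt (frobSq fun i' j' => gram X i' j' - gram X₀ i' j'))|}
      ≤ ENNReal.ofReal (6 * Real.exp (3 * n * d - τ * n ^ 2 * t ^ 2 / 4)) := by
  let e : Ω → EuclideanSpace ℝ (Fin n × Fin n) := fun ω => WithLp.toLp 2 fun p => E ω p.1 p.2
  have he : ∀ a : EuclideanSpace ℝ (Fin n × Fin n), ‖a‖ = 1 → ∀ s : ℝ, 0 < s →
      P {ω | s < |inner ℝ (e ω) a|} ≤ ENNReal.ofReal (2 * Real.exp (-(τ * s ^ 2))) := by
    intro a ha s hs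
    have hnorm := norm_toLp_eq_sqrt_frobSq fun i j => a (i, j)
    have hA : frobSq (fun i j => a (i, j)) = 1 := by
      rw [← Real.sqrt_eq_one, ← hnorm]
      exact ha
    refine (measure_mono fun ω hω => ?_).trans (hsubG _ hA s hs)
    rw [Set.mem_ofPred_eq, ← inner_toLp_eq_frobInner, real_inner_comm]
    exact hω
  rcases Nat.eq_zero_or_pos n with rfl | hn
  · refine (measure_mono_null ?_ measure_empty).trans_le zero_le
    rintro ω ⟨X, hX, -⟩
    exact hX (Subsingleton.elim _ _)
  have hu : 0 < (n : ℝ) * t := by positivity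
  have hv : 0 < (n : ℝ) * t / √2 := by positivity
  have hsub : {ω | ∃ X : Fin n → Fin d → ℝ, gram X ≠ gram X₀ ∧
      (n : ℝ) * t <
        |frobInner (E ω)
          (fun i j => (gram X i j - gram X₀ i j)
            / Real.sqrt (frobSq fun i' j' => gram X i' j' - gram X₀ i' j'))|} ⊆
      {ω | ∃ a ∈ LinearMap.range (symOuter X₀), n * t / √2 * ‖a‖ < |inner ℝ (e ω) a|} ∪
      {ω | ∃ Y, n * t / √2 * ‖outerProd n d Y Y‖ < |inner ℝ (e ω) (outerProd n d Y Y)|} := by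
    rintro ω ⟨X, -, hlt⟩
    obtain ⟨Y, Z, hdec, horth⟩ := exists_orthogonal_decomposition X₀ X
    have hnorm : √(frobSq fun i j => gram X i j - gram X₀ i j) =
        ‖outerProd n d X X - outerProd n d X₀ X₀‖ :=
      (norm_toLp_eq_sqrt_frobSq _).symm
    have hinner : frobInner (E ω) (fun i j => gram X i j - gram X₀ i j) =
        inner ℝ (e ω) (outerProd n d X X - outerProd n d X₀ X₀) :=
      (inner_toLp_eq_frobInner _ _).symm
    have hdiv : ∀ (B : Fin n → Fin n → ℝ) (r : ℝ),
        frobInner (E ω) (fun i j => B i j / r) = frobInner (E ω) B / r := by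
      intro B r
      simp only [frobInner, Finset.sum_div, mul_div_assoc]
    rw [hdiv (fun i j => gram X i j - gram X₀ i j), hinner, hnorm, abs_div, abs_norm] at hlt
    have hpos : 0 < ‖outerProd n d X X - outerProd n d X₀ X₀‖ := by
      refine (norm_nonneg _).lt_of_ne fun h0 => ?_
      rw [← h0, div_zero] at hlt
      exact hu.not_gt hlt
    rw [lt_div_iff₀ hpos, hdec] at hlt
    rcases lt_abs_inner_or_of_orthogonal hu.le horth hlt with h | h
    · exact Or.inl ⟨_, ⟨Z, rfl⟩, h⟩
    · exact Or.inr ⟨Y, h⟩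
  have hexp : τ * (4 / 5 * (n * t / √2)) ^ 2 = 8 / 25 * (τ * n ^ 2 * t ^ 2) := by
    rw [mul_pow, div_pow _ √2, Real.sq_sqrt zero_le_two]
    ring
  have hD : (3 : ℝ) * n * d = 3 * (n * d : ℕ) := by
    push_cast
    ring
  rw [hD]
  rcases net_bound_le_or_one_le (n * d) (τ * n ^ 2 * t ^ 2) with h1 | hnet
  · exact prob_le_one.trans (ENNReal.one_le_ofReal.2 h1)
  calc
    _ ≤ ENNReal.ofReal (3 * Real.exp (3 * (n * d : ℕ) - τ * n ^ 2 * t ^ 2 / 4)) +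
        ENNReal.ofReal (3 * Real.exp (3 * (n * d : ℕ) - τ * n ^ 2 * t ^ 2 / 4)) := by
      refine (measure_mono hsub).trans ((measure_union_le _ _).trans (add_le_add ?_ ?_))
      · refine (subGaussian_tail_over_submodule he _ hv).trans (ENNReal.ofReal_le_ofReal ?_)
        rw [hexp]
        refine le_trans ?_ hnet
        gcongr
        · norm_num
        · exact finrank_range_symOuter_le X₀
      · refine (subGaussian_tail_over_outerProd_self he (fun ω i j => hsymm ω i j) hv).trans
          (ENNReal.ofReal_le_ofReal ?_)
        rw [hexp]
        exact hnet
    _ = _ := by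
      rw [← ENNReal.ofReal_add (by positivity) (by positivity)]
      ring_nf
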